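/- Let L be a Lie algebra over a field K of characteristic different from 2 and 3, and let I be a perfect ideal of L (i.e. [I,I] = I) of codimension 1 (dim_K(L/I) = 1). Then the linear map Z²_comm(L) → Z²_comm(I) given by restricting a commutative 2-cocycle on L to I × I has kernel of dimension at most 1, spanned by a trivial cocycle (a cocycle vanishing whenever one argument lies in I = [L,L]); consequently Z²_comm(L) embeds into Z²_comm(I) ⊕ K. -/

import Mathlib

/-- The space `Z²_comm(L)` of commutative 2-cocycles on a Lie algebra `L`: symmetric bilinear
forms `φ : L × L → K` satisfying `φ([x,y],z) + φ([z,x],y) + φ([y,z],x) = 0`. -/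
def commTwoCocycles (K L : Type*) [Field K] [LieRing L] [LieAlgebra K L] :
    Submodule K (L →ₗ[K] L →ₗ[K] K) where
  carrier := {φ | (∀ x y : L, φ x y = φ y x) ∧
    ∀ x y z : L, φ ⁅x, y⁆ z + φ ⁅z, x⁆ y + φ ⁅y, z⁆ x = 0}
  zero_mem' := by
    refine ⟨fun x y => rfl, fun x y z => by simp⟩
  add_mem' := by
    rintro φ ψ ⟨hφ1, hφ2⟩ ⟨hψ1, hψ2⟩
    refine ⟨fun x y => ?_, fun x y z => ?_⟩
    · simp only [LinearMap.add_apply, hφ1 x y, hψ1 x y]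
    · simp only [LinearMap.add_apply]
      linear_combination hφ2 x y z + hψ2 x y z
  smul_mem' := by
    rintro c φ ⟨h1, h2⟩
    refine ⟨fun x y => ?_, fun x y z => ?_⟩
    · simp only [LinearMap.smul_apply, h1 x y]
    · simp only [LinearMap.smul_apply, smul_eq_mul]
      linear_combination c * h2 x y z

/-- Let `L` be a Lie algebra over a field `K` of characteristic `≠ 2, 3` and
`I` a perfect ideal of codimension 1 in `L`. Then the kernel of the restriction map
`Z²_comm(L) → Z²_comm(I)` has dimension at most 1 and consists of trivial cocycles (cocycles
vanishing whenever one argument lies in `I`); consequently `Z²_comm(L)` embeds into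
`Z²_comm(I) ⊕ K`. -/
theorem cocycles_embed_for_perfect_codim_one_ideal
    (K : Type*) [Field K] (h2 : (2 : K) ≠ 0) (h3 : (3 : K) ≠ 0)
    (L : Type*) [LieRing L] [LieAlgebra K L]
    (I : LieIdeal K L) (hperf : ⁅I, I⁆ = I)
    (hcodim : Module.finrank K (L ⧸ I.toSubmodule) = 1) :
    (∀ φ : L →ₗ[K] L →ₗ[K] K, φ ∈ commTwoCocycles K L →
      (∀ x y : L, x ∈ I → y ∈ I → φ x y = 0) →
      ∀ x y : L, y ∈ I → φ x y = 0) ∧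
    (∀ φ ψ : L →ₗ[K] L →ₗ[K] K, φ ∈ commTwoCocycles K L → ψ ∈ commTwoCocycles K L →
      (∀ x y : L, x ∈ I → y ∈ I → φ x y = 0) →
      (∀ x y : L, x ∈ I → y ∈ I → ψ x y = 0) →
      ∃ c d : K, ¬(c = 0 ∧ d = 0) ∧ c • φ + d • ψ = 0) ∧
    ∃ f : commTwoCocycles K L →ₗ[K] commTwoCocycles K I × K,
      Function.Injective f := by
  classical
  have A : ∀ φ : L →ₗ[K] L →ₗ[K] K, φ ∈ commTwoCocycles K L →
      (∀ x y : L, x ∈ I → y ∈ I → φ x y = 0) →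
      ∀ x y : L, y ∈ I → φ x y = 0 := by
    rintro φ ⟨hs, hc⟩ h0 x y hy
    have hy' : y ∈ (⁅I, I⁆ : LieIdeal K L) := by rw [hperf]; exact hy
    rw [← LieSubmodule.mem_toSubmodule, LieSubmodule.lieIdeal_oper_eq_linear_span'] at hy'
    induction hy' using Submodule.span_induction with
    | mem z hz =>
      obtain ⟨a, ha, b, hb, rfl⟩ := hz
      have h := hc a b x
      rw [h0 _ b (lie_mem_right K L I x a ha) hb, h0 _ a (lie_mem_left K L I b x hb) ha] at h
      rw [hs]
      simpa using h
    | zero => simp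
    | add u v hu hv ihu ihv =>
      have m : ∀ w, w ∈ Submodule.span K {x | ∃ a ∈ I, ∃ b ∈ I, ⁅a, b⁆ = x} → w ∈ I := by
        intro w hw
        rw [← LieSubmodule.lieIdeal_oper_eq_linear_span', LieSubmodule.mem_toSubmodule,
          hperf] at hw
        exact hw
      rw [map_add, ihu (m _ hu), ihv (m _ hv), add_zero]
    | smul c u hu ihu =>
      have m : ∀ w, w ∈ Submodule.span K {x | ∃ a ∈ I, ∃ b ∈ I, ⁅a, b⁆ = x} → w ∈ I := by
        intro w hw
        rw [← LieSubmodule.lieIdeal_oper_eq_linear_span', LieSubmodule.mem_toSubmodule,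
          hperf] at hw
        exact hw
      rw [map_smul, ihu (m _ hu), smul_zero]
  obtain ⟨v, -, hv⟩ := finrank_eq_one_iff'.mp hcodim
  obtain ⟨e, rfl⟩ := Submodule.Quotient.mk_surjective _ v
  have D : ∀ w : L, ∃ c : K, ∃ i ∈ I, w = c • e + i := by
    intro w
    obtain ⟨c, hc⟩ := hv (Submodule.Quotient.mk w)
    refine ⟨c, w - c • e, ?_, by abel⟩
    rw [← Submodule.Quotient.mk_smul, eq_comm, Submodule.Quotient.eq] at hc
    exact hc
  have B : ∀ φ : L →ₗ[K] L →ₗ[K] K, φ ∈ commTwoCocycles K L →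
      (∀ x y : L, x ∈ I → y ∈ I → φ x y = 0) → φ e e = 0 → φ = 0 := by
    intro φ hφ h0 he
    ext x y
    obtain ⟨c, i, hi, rfl⟩ := D x
    obtain ⟨d, j, hj, rfl⟩ := D y
    have h1 := A φ hφ h0 e j hj
    have h2 := A φ hφ h0 i j hj
    have h3 := A φ hφ h0 e i hi
    rw [hφ.1] at h3
    simp [h1, h2, h3, he]
  refine ⟨A, ?_, ?_⟩
  · intro φ ψ hφ hψ h0 k0
    by_cases h : φ e e = 0
    · exact ⟨1, 0, by simp, by simp [B φ hφ h0 h]⟩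
    · refine ⟨ψ e e, -φ e e, by simp [h], ?_⟩
      refine B _ (Submodule.add_mem _ (Submodule.smul_mem _ _ hφ) (Submodule.smul_mem _ _ hψ))
        ?_ ?_
      · intro x y hx hy
        simp [h0 x y hx hy, k0 x y hx hy]
      · simp only [LinearMap.add_apply, LinearMap.smul_apply, smul_eq_mul]
        ring
  · let ι : I →ₗ[K] L := I.toSubmodule.subtype
    let r : commTwoCocycles K L →ₗ[K] commTwoCocycles K I :=
      { toFun := fun φ => ⟨φ.1.compl₁₂ ι ι,
          fun x y => φ.2.1 x y, fun x y z => φ.2.2 x y z⟩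
        map_add' := fun _ _ => rfl
        map_smul' := fun _ _ => rfl }
    let ev : commTwoCocycles K L →ₗ[K] K :=
      { toFun := fun φ => φ.1 e e
        map_add' := fun _ _ => rfl
        map_smul' := fun _ _ => rfl }
    refine ⟨r.prod ev, ?_⟩
    intro φ ψ h
    have h1 : r φ = r ψ := congrArg Prod.fst h
    have h2 : φ.1 e e = ψ.1 e e := congrArg Prod.snd h
    apply Subtype.ext
    have key : φ.1 + (-1 : K) • ψ.1 = 0 := by
      refine B _ (Submodule.add_mem _ φ.2 (Submodule.smul_mem _ _ ψ.2)) ?_ ?_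
      · intro x y hx hy
        have h4 : (r φ).1 ⟨x, hx⟩ ⟨y, hy⟩ = (r ψ).1 ⟨x, hx⟩ ⟨y, hy⟩ := by rw [h1]
        have h5 : φ.1 x y = ψ.1 x y := h4
        simp [h5]
      · simp [h2]
    ext x y
    have h6 := LinearMap.congr_fun (LinearMap.congr_fun key x) y
    simp only [LinearMap.add_apply, LinearMap.smul_apply, smul_eq_mul, LinearMap.zero_apply] at h6
    linear_combination h6
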